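/- arXiv:2010.00279 — 2 statements merged into one kernel-verified Lean document; each statement's English description precedes it below -/
import Mathlib

section
/- Let H be a finite-dimensional complex Hilbert space and let U : ℝ × ℝ → B(H) be a unitary propagator: U(t,s) is unitary for all t,s, U(t,t) = 1, U(t,s)U(s,r) = U(t,r) for all t,s,r, and (t,s) ↦ U(t,s) is jointly continuous. Define, for t ∈ ℝ, the operator Û(t) on L²(ℝ, H) by (Û(t)ξ)(x) = U(x, x−t) ξ(x−t). Then each Û(t) is unitary, Û(0) = 1, Û(t)Û(s) = Û(t+s) for all t,s ∈ ℝ (so (Û(t))_{t∈ℝ} is a one-parameter unitary group), and for every ξ ∈ L²(ℝ, H) the map t ↦ Û(t)ξ is continuous (the group is strongly continuous). -/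
open MeasureTheory Filter Topology

noncomputable section

/-- Translating an element of `L²` is continuous in the translation parameter. -/
theorem continuous_translate_Lp {E : Type*} [NormedAddCommGroup E]
    (η : Lp E 2 (volume : Measure ℝ)) :
    Continuous fun t : ℝ =>
      Lp.compMeasurePreserving (fun x : ℝ => x - t) (measurePreserving_sub_right volume t) η := by
  let g : C(ℝ, C(ℝ, ℝ)) := ContinuousMap.curry ⟨fun p : ℝ × ℝ => p.2 - p.1, by fun_prop⟩
  exact Continuous.compMeasurePreservingLp (f := fun _ : ℝ => η) (g := g) continuous_const
    g.continuous (fun t => measurePreserving_sub_right volume t) (by simp)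

/-- Multiplying an `L²` function by a continuous family of isometries gives an `L²` function. -/
theorem memLp_clm_apply {H : Type*} [NormedAddCommGroup H] [NormedSpace ℂ H]
    {A : ℝ → H →L[ℂ] H} (hA : Continuous A) (hnorm : ∀ t x, ‖A t x‖ = ‖x‖)
    (ξ : Lp H 2 (volume : Measure ℝ)) :
    MemLp (fun x => A x ((ξ : ℝ → H) x)) 2 (volume : Measure ℝ) := by
  have hm : AEStronglyMeasurable (fun x => A x ((ξ : ℝ → H) x)) (volume : Measure ℝ) :=
    (show Continuous fun p : (H →L[ℂ] H) × H => p.1 p.2 by fun_prop).comp_aestronglyMeasurable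
      (hA.aestronglyMeasurable.prodMk (Lp.aestronglyMeasurable ξ))
  exact (Lp.memLp ξ).of_le hm (Eventually.of_forall fun x => (hnorm x _).le)

/-- let `H` be a finite-dimensional complex Hilbert space and `U` a jointly
continuous unitary propagator on `H` (`U(t,t) = 1`, `U(t,s)U(s,r) = U(t,r)`, each `U(t,s)`
unitary).  If `Û(t)` is the operator on `L²(ℝ, H)` given by `(Û(t)ξ)(x) = U(x, x−t)ξ(x−t)`,
then each `Û(t)` is unitary, `Û(0) = 1`, `Û(t)Û(s) = Û(t+s)` (a one-parameter unitary group),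
and `t ↦ Û(t)ξ` is continuous for every `ξ` (strong continuity). -/
theorem statement14
    {H : Type*} [NormedAddCommGroup H] [InnerProductSpace ℂ H] [FiniteDimensional ℂ H]
    (U : ℝ → ℝ → (H →L[ℂ] H))
    (hUnorm : ∀ t s : ℝ, ∀ x : H, ‖U t s x‖ = ‖x‖)
    (hUid : ∀ t : ℝ, U t t = 1)
    (hUcomp : ∀ t s r : ℝ, U t s ∘L U s r = U t r)
    (hUcont : Continuous fun p : ℝ × ℝ => U p.1 p.2)
    (Uhat : ℝ → (Lp H 2 (volume : Measure ℝ) →L[ℂ] Lp H 2 (volume : Measure ℝ)))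
    (hUhat : ∀ (t : ℝ) (ξ : Lp H 2 (volume : Measure ℝ)),
      (Uhat t ξ : ℝ → H) =ᵐ[volume] fun x => U x (x - t) ((ξ : ℝ → H) (x - t))) :
    -- each Û(t) is unitary (isometric and surjective)
    (∀ (t : ℝ) (ξ : Lp H 2 (volume : Measure ℝ)), ‖Uhat t ξ‖ = ‖ξ‖) ∧
    (∀ t : ℝ, Function.Surjective (Uhat t)) ∧
    -- Û(0) = 1
    Uhat 0 = 1 ∧
    -- one-parameter group law
    (∀ t s : ℝ, Uhat t ∘L Uhat s = Uhat (t + s)) ∧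
    -- strong continuity
    (∀ ξ : Lp H 2 (volume : Measure ℝ), Continuous fun t => Uhat t ξ) := by
  have shift (t : ℝ) {p : ℝ → Prop} (h : ∀ᵐ x, p x) : ∀ᵐ x, p (x - t) :=
    (measurePreserving_sub_right volume t).quasiMeasurePreserving.ae h
  have hcomp (t s r : ℝ) (v : H) : U t s (U s r v) = U t r v := by
    rw [← hUcomp t s r, ContinuousLinearMap.comp_apply]
  have hzero : Uhat 0 = 1 := by
    ext1 ξ
    refine Lp.ext ?_
    filter_upwards [hUhat 0 ξ] with x hx
    simp [hx, hUid]
  have hgroup (t s : ℝ) : Uhat t ∘L Uhat s = Uhat (t + s) := by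
    ext1 ξ
    refine Lp.ext ?_
    filter_upwards [hUhat t (Uhat s ξ), shift t (hUhat s ξ), hUhat (t + s) ξ] with x h₁ h₂ h₃
    rw [ContinuousLinearMap.comp_apply, h₁, h₂, h₃, hcomp, sub_sub]
  refine ⟨fun t ξ => ?_, fun t ξ => ⟨Uhat (-t) ξ, ?_⟩, hzero, hgroup, fun ξ => ?_⟩
  · rw [← Lp.norm_compMeasurePreserving ξ (measurePreserving_sub_right volume t),
      Lp.norm_def, Lp.norm_def]
    congr 1
    refine eLpNorm_congr_norm_ae ?_
    filter_upwards [hUhat t ξ,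
      Lp.coeFn_compMeasurePreserving ξ (measurePreserving_sub_right volume t)] with x h₁ h₂
    rw [h₁, h₂, hUnorm, Function.comp_apply]
  · rw [← ContinuousLinearMap.comp_apply, hgroup, add_neg_cancel, hzero,
      one_apply_eq_self]
  · -- In the interaction picture `η x = U 0 x (ξ x)` the evolution is translation.
    have hη := memLp_clm_apply (A := fun x => U 0 x)
      (hUcont.comp (continuous_const.prodMk continuous_id)) (hUnorm 0) ξ
    have hUη (t : ℝ) : ∀ᵐ x, (Uhat t ξ : ℝ → H) x =
        U x 0 ((Lp.compMeasurePreserving (fun x : ℝ => x - t)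
          (measurePreserving_sub_right volume t) hη.toLp : ℝ → H) x) := by
      filter_upwards [hUhat t ξ, shift t hη.coeFn_toLp,
        Lp.coeFn_compMeasurePreserving hη.toLp (measurePreserving_sub_right volume t)]
        with x h₁ h₂ h₃
      rw [h₁, h₃, Function.comp_apply, h₂, hcomp]
    have hT := continuous_translate_Lp hη.toLp
    refine continuous_iff_continuousAt.2 fun s => tendsto_iff_dist_tendsto_zero.2 ?_
    refine (tendsto_iff_dist_tendsto_zero.1 hT.continuousAt).congr fun t => ?_
    rw [dist_eq_norm, dist_eq_norm, Lp.norm_def, Lp.norm_def]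
    congr 1
    refine eLpNorm_congr_norm_ae ?_
    filter_upwards [hUη t, hUη s, Lp.coeFn_sub (Uhat t ξ) (Uhat s ξ),
      Lp.coeFn_sub
        (Lp.compMeasurePreserving (fun x : ℝ => x - t)
          (measurePreserving_sub_right volume t) hη.toLp)
        (Lp.compMeasurePreserving (fun x : ℝ => x - s)
          (measurePreserving_sub_right volume s) hη.toLp)] with x h₁ h₂ h₃ h₄
    rw [h₃, h₄, Pi.sub_apply, Pi.sub_apply, h₁, h₂, ← map_sub, hUnorm]

end
end

section
/- Let H be a finite-dimensional complex Hilbert space and let H₁, H₂ : [0, T] → B(H) be integrable functions with H_j(s) self-adjoint for each s. Let U₁, U₂ : [0, T] → B(H) be the corresponding propagators, i.e. the solutions of U_j(t) = 1 − i ∫₀ᵗ H_j(s) U_j(s) ds. Then for every t ∈ [0, T], ‖U₁(t) − U₂(t)‖ ≤ ∫₀ᵗ ‖H₁(s) − H₂(s)‖ ds, where ‖·‖ is the operator norm. -/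
open MeasureTheory Filter Topology

noncomputable section

namespace AbsolutelyContinuousOnInterval

/-- A function whose increments are dominated by those of an absolutely continuous function is
absolutely continuous. -/
theorem of_dist_le {X Y : Type*} [PseudoMetricSpace X] [PseudoMetricSpace Y] {f : ℝ → X}
    {g : ℝ → Y} {a b : ℝ} (hg : AbsolutelyContinuousOnInterval g a b)
    (h : ∀ x ∈ Set.uIcc a b, ∀ y ∈ Set.uIcc a b, dist (f x) (f y) ≤ dist (g x) (g y)) :
    AbsolutelyContinuousOnInterval f a b := by
  unfold AbsolutelyContinuousOnInterval at hg ⊢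
  refine squeeze_zero' (.of_forall fun _ ↦ Finset.sum_nonneg fun _ _ ↦ dist_nonneg) ?_ hg
  rw [eventually_inf_principal]
  filter_upwards with E hE
  exact Finset.sum_le_sum fun i hi ↦ h _ (hE.1 i hi).1 _ (hE.1 i hi).2

/-- The product of two absolutely continuous functions with values in a seminormed ring is
absolutely continuous. -/
theorem mul_of_seminormedRing {R : Type*} [SeminormedRing R] {f g : ℝ → R} {a b : ℝ}
    (hf : AbsolutelyContinuousOnInterval f a b) (hg : AbsolutelyContinuousOnInterval g a b) :
    AbsolutelyContinuousOnInterval (fun x ↦ f x * g x) a b := by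
  obtain ⟨C, hC⟩ := hf.exists_bound
  obtain ⟨D, hD⟩ := hg.exists_bound
  unfold AbsolutelyContinuousOnInterval at hf hg ⊢
  refine squeeze_zero' (.of_forall fun _ ↦ Finset.sum_nonneg fun _ _ ↦ dist_nonneg) ?_
    (by simpa using (hg.const_mul C).add (hf.const_mul D))
  rw [eventually_inf_principal]
  filter_upwards with E hE
  simp only [Finset.mul_sum, ← Finset.sum_add_distrib]
  refine Finset.sum_le_sum fun i hi ↦ ?_
  obtain ⟨h₁, h₂⟩ := hE.1 i hi
  set x := (E.2 i).1
  set y := (E.2 i).2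
  simp only [dist_eq_norm]
  calc ‖f x * g x - f y * g y‖ = ‖f x * (g x - g y) + (f x - f y) * g y‖ := by
        congr 1; noncomm_ring
    _ ≤ ‖f x‖ * ‖g x - g y‖ + ‖f x - f y‖ * ‖g y‖ :=
        norm_add_le_of_le (norm_mul_le _ _) (norm_mul_le _ _)
    _ ≤ C * ‖g x - g y‖ + D * ‖f x - f y‖ := by
        rw [mul_comm ‖f x - f y‖]
        gcongr
        exacts [hC x h₁, hD y h₂]

/-- The fundamental theorem of calculus for a Banach-space valued absolutely continuous function
with an integrable almost everywhere derivative. -/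
theorem integral_eq_sub_of_ae_hasDerivAt {F : Type*} [NormedAddCommGroup F] [NormedSpace ℝ F]
    [CompleteSpace F] {f f' : ℝ → F} {a b : ℝ} (hf : AbsolutelyContinuousOnInterval f a b)
    (hf' : IntervalIntegrable f' volume a b)
    (hac : AbsolutelyContinuousOnInterval (fun x ↦ ∫ s in a..x, f' s) a b)
    (hd : ∀ᵐ x, x ∈ Set.uIcc a b → HasDerivAt f (f' x) x) :
    ∫ x in a..b, f' x = f b - f a := by
  obtain ⟨C, hC⟩ := (hf.fun_sub hac).const_of_ae_hasDerivAt_zero (by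
    filter_upwards [hd, hf'.ae_hasDerivAt_integral] with x h₁ h₂ hx
    simpa using (h₁ hx).fun_sub (h₂ hx a Set.left_mem_uIcc))
  have ha := hC a Set.left_mem_uIcc
  have hb := hC b Set.right_mem_uIcc
  simp only [intervalIntegral.integral_same, sub_zero] at ha
  rw [ha, ← hb, sub_sub_cancel]

end AbsolutelyContinuousOnInterval

/-- The indefinite integral of a Banach-space valued integrable function is absolutely
continuous. -/
theorem IntervalIntegrable.absolutelyContinuousOnInterval_integral {F : Type*}
    [NormedAddCommGroup F] [NormedSpace ℝ F] {f : ℝ → F} {a b : ℝ}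
    (hf : IntervalIntegrable f volume a b) :
    AbsolutelyContinuousOnInterval (fun x ↦ ∫ s in a..x, f s) a b := by
  refine (hf.norm.absolutelyContinuousOnInterval_intervalIntegral
    Set.left_mem_uIcc).of_dist_le fun x hx y hy ↦ ?_
  have hi : ∀ z ∈ Set.uIcc a b, IntervalIntegrable f volume a z := fun z hz ↦
    hf.mono_set (Set.uIcc_subset_uIcc_left hz)
  rw [dist_eq_norm, dist_eq_norm, intervalIntegral.integral_interval_sub_left (hi x hx) (hi y hy),
    intervalIntegral.integral_interval_sub_left (hi x hx).norm (hi y hy).norm]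
  exact intervalIntegral.norm_integral_le_abs_integral_norm

section Propagator

variable {E : Type*} [NormedAddCommGroup E] [InnerProductSpace ℂ E] [FiniteDimensional ℂ E]
  {t : ℝ} {H H₁ H₂ U U₁ U₂ : ℝ → E →L[ℂ] E}

/-- `U` is a propagator of the Hamiltonian `H` on `[0, t]`. -/
structure IsPropagatorOn (H U : ℝ → E →L[ℂ] E) (t : ℝ) : Prop where
  nonneg : 0 ≤ t
  intervalIntegrable : IntervalIntegrable H volume 0 t
  isSelfAdjoint : ∀ s ∈ Set.Icc 0 t, IsSelfAdjoint (H s)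
  continuousOn : ContinuousOn U (Set.Icc 0 t)
  eq_sub_integral : ∀ s ∈ Set.Icc 0 t, U s = 1 - Complex.I • ∫ r in (0 : ℝ)..s, H r * U r

namespace IsPropagatorOn

theorem intervalIntegrable_mul (h : IsPropagatorOn H U t) :
    IntervalIntegrable (fun s ↦ H s * U s) volume 0 t :=
  h.intervalIntegrable.mul_continuousOn (by simpa [Set.uIcc_of_le h.nonneg] using h.continuousOn)

theorem apply_zero (h : IsPropagatorOn H U t) : U 0 = 1 := by
  simpa using h.eq_sub_integral 0 ⟨le_rfl, h.nonneg⟩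

theorem absolutelyContinuousOnInterval (h : IsPropagatorOn H U t) :
    AbsolutelyContinuousOnInterval U 0 t := by
  refine h.intervalIntegrable_mul.absolutelyContinuousOnInterval_integral.of_dist_le
    fun x hx y hy ↦ ?_
  rw [Set.uIcc_of_le h.nonneg] at hx hy
  rw [h.eq_sub_integral x hx, h.eq_sub_integral y hy, dist_sub_left, dist_eq_norm,
    dist_eq_norm, ← smul_sub, norm_smul, Complex.norm_I, one_mul]

theorem ae_hasDerivAt (h : IsPropagatorOn H U t) :
    ∀ᵐ x, x ∈ Set.uIcc 0 t → HasDerivAt U (-(Complex.I • (H x * U x))) x := by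
  have h₀ : ∀ᵐ x : ℝ, x ≠ 0 := by simp [ae_iff, measure_singleton]
  have ht : ∀ᵐ x : ℝ, x ≠ t := by simp [ae_iff, measure_singleton]
  filter_upwards [h.intervalIntegrable_mul.ae_hasDerivAt_integral, h₀, ht] with x hx hx₀ hxt hmem
  have hd := ((hx hmem 0 Set.left_mem_uIcc).fun_const_smul Complex.I).const_sub 1
  rw [Set.uIcc_of_le h.nonneg] at hmem
  refine hd.congr_of_eventuallyEq ?_
  filter_upwards [Icc_mem_nhds (lt_of_le_of_ne hmem.1 hx₀.symm) (lt_of_le_of_ne hmem.2 hxt)]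
    with y hy using h.eq_sub_integral y hy

/-- Duhamel's formula for the overlap of two propagators. -/
theorem star_mul_sub_one (h₁ : IsPropagatorOn H₁ U₁ t) (h₂ : IsPropagatorOn H₂ U₂ t) :
    star (U₁ t) * U₂ t - 1 =
      ∫ s in (0 : ℝ)..t, Complex.I • (star (U₁ s) * (H₁ s - H₂ s) * U₂ s) := by
  have hc₁ : ContinuousOn (fun s ↦ star (U₁ s)) (Set.uIcc 0 t) := by
    simpa [Set.uIcc_of_le h₁.nonneg] using h₁.continuousOn.star
  have hc₂ : ContinuousOn U₂ (Set.uIcc 0 t) := by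
    simpa [Set.uIcc_of_le h₂.nonneg] using h₂.continuousOn
  have hint : IntervalIntegrable (fun s ↦ Complex.I • (star (U₁ s) * (H₁ s - H₂ s) * U₂ s))
      volume 0 t :=
    (((h₁.intervalIntegrable.sub h₂.intervalIntegrable).continuousOn_mul hc₁).mul_continuousOn
      hc₂).smul Complex.I
  have hac₁ : AbsolutelyContinuousOnInterval (fun s ↦ star (U₁ s)) 0 t :=
    h₁.absolutelyContinuousOnInterval.of_dist_le fun x _ y _ ↦ by
      rw [dist_eq_norm, dist_eq_norm, ← star_sub, norm_star]
  rw [(hac₁.mul_of_seminormedRing h₂.absolutelyContinuousOnInterval).integral_eq_sub_of_ae_hasDerivAt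
    hint hint.absolutelyContinuousOnInterval_integral]
  · simp [h₁.apply_zero, h₂.apply_zero]
  · filter_upwards [h₁.ae_hasDerivAt, h₂.ae_hasDerivAt] with x hx₁ hx₂ hx
    convert! (hx₁ hx).star.fun_mul (hx₂ hx) using 1
    rw [Set.uIcc_of_le h₁.nonneg] at hx
    simp only [star_neg, star_smul, star_mul, (h₁.isSelfAdjoint x hx).star_eq, RCLike.star_def,
      Complex.conj_I, neg_smul, neg_neg, smul_mul_assoc, mul_neg, mul_smul_comm, mul_sub, sub_mul,
      smul_sub, mul_assoc]
    rw [sub_eq_add_neg]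

theorem star_mul_self (h : IsPropagatorOn H U t) : star (U t) * U t = 1 := by
  simpa [sub_eq_zero] using h.star_mul_sub_one h

theorem mono (h : IsPropagatorOn H U t) {s : ℝ} (hs : s ∈ Set.Icc 0 t) : IsPropagatorOn H U s where
  nonneg := hs.1
  intervalIntegrable := h.intervalIntegrable.mono_set
    (Set.uIcc_subset_uIcc_left (by rwa [Set.uIcc_of_le h.nonneg]))
  isSelfAdjoint r hr := h.isSelfAdjoint r ⟨hr.1, hr.2.trans hs.2⟩
  continuousOn := h.continuousOn.mono (Set.Icc_subset_Icc_right hs.2)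
  eq_sub_integral r hr := h.eq_sub_integral r ⟨hr.1, hr.2.trans hs.2⟩

theorem norm_le_one (h : IsPropagatorOn H U t) : ‖U t‖ ≤ 1 := by
  have h₁ : ‖U t‖ * ‖U t‖ ≤ 1 := by
    rw [← CStarRing.norm_star_mul_self, h.star_mul_self]
    exact ContinuousLinearMap.norm_id_le
  nlinarith [norm_nonneg (U t)]

theorem mul_star_self (h : IsPropagatorOn H U t) : U t * star (U t) = 1 := by
  have h₁ := congrArg (ContinuousLinearMap.toLinearMap) h.star_mul_self
  exact ContinuousLinearMap.coe_injective (mul_eq_one_comm.mp h₁)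

theorem norm_sub_le (h₁ : IsPropagatorOn H₁ U₁ t) (h₂ : IsPropagatorOn H₂ U₂ t) :
    ‖U₁ t - U₂ t‖ ≤ ∫ s in (0 : ℝ)..t, ‖H₁ s - H₂ s‖ := by
  have hfactor : U₁ t - U₂ t = -(U₁ t * (star (U₁ t) * U₂ t - 1)) := by
    rw [mul_sub, ← mul_assoc, h₁.mul_star_self, one_mul, mul_one, neg_sub]
  calc ‖U₁ t - U₂ t‖ ≤ ‖U₁ t‖ * ‖star (U₁ t) * U₂ t - 1‖ := by
        rw [hfactor, norm_neg]
        exact norm_mul_le _ _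
    _ ≤ ‖star (U₁ t) * U₂ t - 1‖ := mul_le_of_le_one_left (norm_nonneg _) h₁.norm_le_one
    _ ≤ ∫ s in (0 : ℝ)..t, ‖H₁ s - H₂ s‖ := by
        rw [h₁.star_mul_sub_one h₂]
        refine intervalIntegral.norm_integral_le_of_norm_le h₁.nonneg (.of_forall fun s hs ↦ ?_)
          (h₁.intervalIntegrable.sub h₂.intervalIntegrable).norm
        have hs' := Set.Ioc_subset_Icc_self hs
        calc ‖Complex.I • (star (U₁ s) * (H₁ s - H₂ s) * U₂ s)‖
            = ‖star (U₁ s) * (H₁ s - H₂ s) * U₂ s‖ := by simp [norm_smul]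
          _ ≤ ‖U₁ s‖ * ‖H₁ s - H₂ s‖ * ‖U₂ s‖ := by
              rw [← norm_star (U₁ s)]
              exact norm_mul₃_le
          _ ≤ 1 * ‖H₁ s - H₂ s‖ * 1 := by
              gcongr
              exacts [(h₁.mono hs').norm_le_one, (h₂.mono hs').norm_le_one]
          _ = ‖H₁ s - H₂ s‖ := by ring

end IsPropagatorOn

end Propagator

/-- let `H` be a finite-dimensional complex Hilbert space and `H₁, H₂` integrable
self-adjoint-valued time-dependent Hamiltonians on `[0, T]`, with propagators `U₁, U₂` solving
`U_j(t) = 1 − i ∫₀ᵗ H_j(s) U_j(s) ds`.  Then `‖U₁(t) − U₂(t)‖ ≤ ∫₀ᵗ ‖H₁(s) − H₂(s)‖ ds` for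
every `t ∈ [0, T]`. -/
theorem statement15
    {E : Type*} [NormedAddCommGroup E] [InnerProductSpace ℂ E] [FiniteDimensional ℂ E]
    (T : ℝ) (hT : 0 ≤ T) (H₁ H₂ : ℝ → E →L[ℂ] E)
    (hH₁ : IntegrableOn H₁ (Set.Icc 0 T) volume)
    (hH₂ : IntegrableOn H₂ (Set.Icc 0 T) volume)
    (hsa₁ : ∀ s ∈ Set.Icc (0:ℝ) T, IsSelfAdjoint (H₁ s))
    (hsa₂ : ∀ s ∈ Set.Icc (0:ℝ) T, IsSelfAdjoint (H₂ s))
    (U₁ U₂ : ℝ → E →L[ℂ] E)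
    (hU₁c : ContinuousOn U₁ (Set.Icc 0 T)) (hU₂c : ContinuousOn U₂ (Set.Icc 0 T))
    (hU₁ : ∀ t ∈ Set.Icc (0:ℝ) T,
      U₁ t = 1 - Complex.I • ∫ s in (0:ℝ)..t, (H₁ s) ∘L (U₁ s))
    (hU₂ : ∀ t ∈ Set.Icc (0:ℝ) T,
      U₂ t = 1 - Complex.I • ∫ s in (0:ℝ)..t, (H₂ s) ∘L (U₂ s)) :
    ∀ t ∈ Set.Icc (0:ℝ) T, ‖U₁ t - U₂ t‖ ≤ ∫ s in (0:ℝ)..t, ‖H₁ s - H₂ s‖ := by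
  have hi : ∀ {H : ℝ → E →L[ℂ] E}, IntegrableOn H (Set.Icc 0 T) volume →
      IntervalIntegrable H volume 0 T := fun h ↦
    IntegrableOn.intervalIntegrable (by rwa [Set.uIcc_of_le hT])
  intro t ht
  exact (IsPropagatorOn.mono ⟨hT, hi hH₁, hsa₁, hU₁c, hU₁⟩ ht).norm_sub_le
    (IsPropagatorOn.mono ⟨hT, hi hH₂, hsa₂, hU₂c, hU₂⟩ ht)

end
end
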